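/- Let d be an admissible sequence, let a and b be admissible families, and for each integer l with |l| < l₁ let e_l be an l-stabilized family. Define D(n,m,l) = c^{2n+m+l} q^{n+(m+l)/2} a(n,m) for l ≥ l₁; D(n,m,l) = c^{2n+m+l} q^{n+(m-l)/2} b(n,m) for l ≤ -l₁; and D(n,m,l) = e_l(n,m) for |l| < l₁. Then for every real s > 0 the triple series S(s) = Σ_{n∈ℤ} Σ_{m≥0} Σ_{l∈ℤ} α^l q^{-m} d_m D(n,m,l) (q^{s(|n+m+l|+|n+l|)} - q^{s(|n+m|+|n|)}) converges absolutely, and lim_{s→0⁺} s·S(s) = 0. -/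

import Mathlib

open Filter Topology

noncomputable section

/-- `qc q x` is the real power `q ^ x`, viewed as a complex number. -/
def qc (q : ℝ) (x : ℝ) : ℂ := ((q ^ x : ℝ) : ℂ)

/-- An admissible sequence: `d m = q^(m/2) (c₁ c^m + c₂ c^(-m))` for all `m ≥ l₁`. -/
def IsAdmissibleSeq (q : ℝ) (c : ℂ) (l₁ : ℤ) (d : ℕ → ℂ) : Prop :=
  ∃ c₁ c₂ : ℂ, ∀ m : ℕ, l₁ ≤ (m : ℤ) →
    d m = qc q ((m : ℝ) / 2) * (c₁ * c ^ (m : ℤ) + c₂ * c ^ (-(m : ℤ)))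

/-- An admissible family on `ℤ × ℕ`, given by region asymptotics. -/
def IsAdmissibleFam (q : ℝ) (l₁ : ℤ) (a : ℤ → ℕ → ℂ) : Prop :=
  ∃ (k₁ k₂ k₃ : ℂ) (A B : ℤ → ℂ), ∀ (n : ℤ) (m : ℕ),
    (l₁ ≤ n → a n m = k₁) ∧
    (-l₁ < n → n < l₁ → l₁ ≤ n + (m : ℤ) → a n m = A n) ∧
    (n ≤ -l₁ → l₁ ≤ n + (m : ℤ) → a n m = qc q (-(n : ℝ)) * k₂) ∧
    (n ≤ -l₁ → -l₁ < n + (m : ℤ) → n + (m : ℤ) < l₁ →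
      a n m = qc q (-(n : ℝ)) * B (n + m)) ∧
    (n + (m : ℤ) ≤ -l₁ → a n m = qc q (-(2 * (n : ℝ) + (m : ℝ))) * k₃)

/-- An `l`-stabilized family on `ℤ × ℕ` (the regions do not depend on `l`). -/
def IsStabilizedFam (q : ℝ) (c : ℂ) (l₁ : ℤ) (e : ℤ → ℕ → ℂ) : Prop :=
  ∃ (u w : ℂ) (f v : ℤ → ℂ) (N : ℤ), 2 * l₁ < N ∧ ∀ (n : ℤ) (m : ℕ),
    (l₁ ≤ n → e n m = (c ^ 2 * (q : ℂ)) ^ n * (c * qc q (1 / 2)) ^ m * u) ∧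
    (-l₁ < n → n < l₁ → N ≤ (m : ℤ) → e n m = (c * qc q (1 / 2)) ^ m * f n) ∧
    (n ≤ -l₁ → -l₁ < n + (m : ℤ) → n + (m : ℤ) < l₁ → N ≤ (m : ℤ) →
      e n m = qc q ((m : ℝ) / 2) * c ^ (-(m : ℤ)) * v (n + m)) ∧
    (n + (m : ℤ) ≤ -l₁ → e n m = (c ^ 2 * (q : ℂ)⁻¹) ^ n * (c * qc q (-(1 / 2))) ^ m * w)

theorem norm_qc {q : ℝ} (hq0 : 0 < q) (x : ℝ) : ‖qc q x‖ = q ^ x := by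
  rw [qc, Complex.norm_real, Real.norm_of_nonneg (Real.rpow_nonneg hq0.le x)]

theorem abs_rpow_sub_rpow_le {q : ℝ} (hq0 : 0 < q) (hq1 : q < 1) (A B : ℝ) :
    |q ^ A - q ^ B| ≤ -Real.log q * |A - B| * q ^ min A B := by
  wlog h : A ≤ B generalizing A B
  · rw [abs_sub_comm, abs_sub_comm A, min_comm]
    exact this B A (le_of_not_ge h)
  have hpos := Real.rpow_pos_of_pos hq0 A
  have hB : q ^ B = q ^ A * q ^ (B - A) := by
    rw [← Real.rpow_add hq0]; congr 1; ring
  have hle : q ^ B ≤ q ^ A := Real.rpow_le_rpow_of_exponent_ge hq0 hq1.le h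
  have hexp : Real.log q * (B - A) + 1 ≤ q ^ (B - A) := by
    rw [Real.rpow_def_of_pos hq0]; exact Real.add_one_le_exp _
  rw [abs_of_nonneg (by linarith), abs_of_nonpos (by linarith), min_eq_left h, hB]
  nlinarith

/-- The two-sided geometric series `∑ q ^ (t |z|)` over the integers. -/
theorem hasSum_rpow_abs {q : ℝ} (hq0 : 0 < q) (hq1 : q < 1) {t : ℝ} (ht : 0 < t) :
    HasSum (fun z : ℤ => q ^ (t * |(z : ℝ)|)) ((1 - q ^ t)⁻¹ + (1 - q ^ t)⁻¹ * q ^ t) := by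
  have h0 : 0 ≤ q ^ t := Real.rpow_nonneg hq0.le t
  have h1 : q ^ t < 1 := Real.rpow_lt_one hq0.le hq1 ht
  have hg := hasSum_geometric_of_lt_one h0 h1
  have hpow : ∀ k : ℕ, q ^ (t * (k : ℝ)) = (q ^ t) ^ k := fun k => by
    rw [Real.rpow_mul hq0.le, Real.rpow_natCast]
  refine HasSum.of_nat_of_neg_add_one ?_ ?_
  · convert hg using 2 with k
    rw [← hpow]; simp
  · have h : ∀ k : ℕ, q ^ (t * |((-((k : ℤ) + 1) : ℤ) : ℝ)|) = (q ^ t) ^ k * q ^ t := fun k => by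
      rw [← pow_succ, ← hpow]
      push_cast
      rw [abs_neg, abs_of_nonneg (by positivity)]
    simpa only [h] using hg.mul_right (q ^ t)

theorem mul_tsum_rpow_abs_le {q : ℝ} (hq0 : 0 < q) (hq1 : q < 1) {s : ℝ} (hs : 0 < s)
    (hs1 : s ≤ 1) : s * ∑' z : ℤ, q ^ (s * |(z : ℝ)|) ≤ 2 / (1 - q) := by
  rw [(hasSum_rpow_abs hq0 hq1 hs).tsum_eq]
  have h1 : q ^ s < 1 := Real.rpow_lt_one hq0.le hq1 hs
  have hb : q ^ s ≤ 1 + s * (q - 1) := by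
    have := rpow_one_add_le_one_add_mul_self (s := q - 1) (p := s) (by linarith) hs.le hs1
    simpa using this
  have hq : 0 < 1 - q := by linarith
  have hqs : 0 < 1 - q ^ s := by linarith
  have : s * ((1 - q ^ s)⁻¹ + (1 - q ^ s)⁻¹ * q ^ s) = s * (1 + q ^ s) / (1 - q ^ s) := by
    field_simp
  rw [this, div_le_div_iff₀ hqs hq]
  have := mul_nonneg (mul_nonneg hs.le hq.le) hqs.le
  linarith

/-- A bound valid off a finite set extends to a global bound. -/
theorem exists_bound_of_finite_exception {ι : Type*} {f g : ι → ℝ} (hg : ∀ p, 0 < g p)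
    (K : Finset ι) {P : ι → Prop} {C₀ : ℝ} (h : ∀ p, p ∉ K → P p → f p ≤ C₀ * g p) :
    ∃ C : ℝ, 0 ≤ C ∧ ∀ p, P p → f p ≤ C * g p := by
  have hnn : ∀ p ∈ K, 0 ≤ |f p| / g p := fun p _ => div_nonneg (abs_nonneg _) (hg p).le
  have hS : 0 ≤ ∑ p ∈ K, |f p| / g p := Finset.sum_nonneg hnn
  refine ⟨|C₀| + ∑ p ∈ K, |f p| / g p, by positivity, fun p hp => ?_⟩
  by_cases hK : p ∈ K
  · have h1 : |f p| / g p ≤ ∑ p ∈ K, |f p| / g p := Finset.single_le_sum hnn hK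
    rw [div_le_iff₀ (hg p)] at h1
    nlinarith [le_abs_self (f p), mul_nonneg (abs_nonneg C₀) (hg p).le]
  · nlinarith [h p hK hp, mul_le_mul_of_nonneg_right (le_abs_self C₀) (hg p).le,
      mul_nonneg hS (hg p).le]

/-- The exponent governing the decay of the matrix coefficients. -/
def decayExp (n : ℤ) (m : ℕ) : ℝ := ((max n 0 + max (-(n + (m : ℤ))) 0 : ℤ) : ℝ)

theorem exists_bound_of_regions {q : ℝ} (hq0 : 0 < q) (hq1 : q < 1) {l₁ : ℤ} (hl₁ : 0 < l₁)
    (F : ℤ → ℕ → ℝ) (k k' : ℝ) (A B : ℤ → ℝ) (N : ℤ)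
    (h₁ : ∀ n m, l₁ ≤ n → F n m ≤ k * q ^ (n : ℝ))
    (h₂ : ∀ (n : ℤ) (m : ℕ), -l₁ < n → n < l₁ → N ≤ (m : ℤ) → F n m ≤ A n)
    (h₃ : ∀ (n : ℤ) (m : ℕ), n ≤ -l₁ → -l₁ < n + (m : ℤ) → n + (m : ℤ) < l₁ → N ≤ (m : ℤ) →
      F n m ≤ B (n + m))
    (h₄ : ∀ (n : ℤ) (m : ℕ), n + (m : ℤ) ≤ -l₁ → F n m ≤ k' * q ^ (-((n : ℝ) + m))) :
    ∃ C : ℝ, 0 ≤ C ∧ ∀ (n : ℤ) (m : ℕ), ¬(n ≤ -l₁ ∧ l₁ ≤ n + (m : ℤ)) →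
      F n m ≤ C * q ^ decayExp n m := by
  set SA := ∑ z ∈ Finset.Ioo (-l₁) l₁, |A z|
  set SB := ∑ z ∈ Finset.Ioo (-l₁) l₁, |B z|
  have hA : ∀ z, -l₁ < z → z < l₁ → A z ≤ SA := fun z h h' =>
    (le_abs_self _).trans (Finset.single_le_sum (f := fun z => |A z|)
      (fun _ _ => abs_nonneg _) (Finset.mem_Ioo.2 ⟨h, h'⟩))
  have hB : ∀ z, -l₁ < z → z < l₁ → B z ≤ SB := fun z h h' =>
    (le_abs_self _).trans (Finset.single_le_sum (f := fun z => |B z|)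
      (fun _ _ => abs_nonneg _) (Finset.mem_Ioo.2 ⟨h, h'⟩))
  have hSA : 0 ≤ SA := Finset.sum_nonneg fun _ _ => abs_nonneg _
  have hSB : 0 ≤ SB := Finset.sum_nonneg fun _ _ => abs_nonneg _
  set C₀ := |k| + |k'| + SA + SB
  have key : ∀ (x u v : ℝ), x ≤ C₀ → v ≤ u + l₁ →
      x * q ^ u ≤ C₀ * q ^ (-(l₁ : ℝ)) * q ^ v := fun x u v hx hv => by
    rw [mul_assoc, ← Real.rpow_add hq0]
    have := Real.rpow_le_rpow_of_exponent_ge hq0 hq1.le (by linarith : -(l₁ : ℝ) + v ≤ u)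
    exact mul_le_mul hx this (Real.rpow_nonneg hq0.le _) (by positivity)
  obtain ⟨C, hC, h⟩ := exists_bound_of_finite_exception (ι := ℤ × ℕ)
    (f := fun p => F p.1 p.2) (g := fun p => q ^ decayExp p.1 p.2)
    (fun p => Real.rpow_pos_of_pos hq0 _)
    (Finset.Ioo (-(N + 2 * |l₁|) - l₁) l₁ ×ˢ Finset.range N.toNat)
    (P := fun p => ¬(p.1 ≤ -l₁ ∧ l₁ ≤ p.1 + (p.2 : ℤ)))
    (C₀ := C₀ * q ^ (-(l₁ : ℝ))) (by
      rintro ⟨n, m⟩ hK hP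
      simp only [Finset.mem_product, Finset.mem_Ioo, Finset.mem_range] at hK
      rw [abs_of_pos hl₁] at hK
      simp only at hP ⊢
      rcases le_or_gt l₁ n with hn | hn
      · refine (h₁ n m hn).trans (key _ _ _ ?_ ?_)
        · linarith [le_abs_self k, abs_nonneg k']
        · have : max n 0 + max (-(n + (m : ℤ))) 0 ≤ n + l₁ := by omega
          unfold decayExp; exact_mod_cast this
      rcases lt_or_ge (-l₁) n with hn' | hn'
      · refine (h₂ n m hn' hn (by omega)).trans ?_
        have := key (A n) 0 (decayExp n m)
          (by linarith [hA n hn' hn, abs_nonneg k, abs_nonneg k']) ?_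
        · simpa using this
        · have hm : N ≤ (m : ℤ) := by omega
          have : max n 0 + max (-(n + (m : ℤ))) 0 ≤ 0 + l₁ := by omega
          unfold decayExp; exact_mod_cast this
      rcases le_or_gt (n + (m : ℤ)) (-l₁) with hx | hx
      · refine (h₄ n m hx).trans (key _ _ _ ?_ ?_)
        · linarith [le_abs_self k', abs_nonneg k]
        · have : max n 0 + max (-(n + (m : ℤ))) 0 ≤ -(n + m) + l₁ := by omega
          unfold decayExp; exact_mod_cast this
      · have hx' : n + (m : ℤ) < l₁ := by omega
        refine (h₃ n m hn' hx hx' (by omega)).trans ?_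
        have := key (B (n + m)) 0 (decayExp n m)
          (by linarith [hB _ hx hx', abs_nonneg k, abs_nonneg k']) ?_
        · simpa using this
        · have : max n 0 + max (-(n + (m : ℤ))) 0 ≤ 0 + l₁ := by omega
          unfold decayExp; exact_mod_cast this)
  exact ⟨C, hC, fun n m hnm => h (n, m) hnm⟩

theorem IsAdmissibleSeq.exists_bound {q : ℝ} (hq0 : 0 < q) {c : ℂ} (hc : ‖c‖ = 1) {l₁ : ℤ}
    {d : ℕ → ℂ} (hd : IsAdmissibleSeq q c l₁ d) :
    ∃ C : ℝ, 0 ≤ C ∧ ∀ m : ℕ, ‖d m‖ ≤ C * q ^ ((m : ℝ) / 2) := by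
  obtain ⟨c₁, c₂, hd⟩ := hd
  obtain ⟨C, hC, h⟩ := exists_bound_of_finite_exception (f := fun m => ‖d m‖)
    (g := fun m : ℕ => q ^ ((m : ℝ) / 2)) (fun p => Real.rpow_pos_of_pos hq0 _)
    (Finset.range l₁.toNat) (P := fun _ => True) (C₀ := ‖c₁‖ + ‖c₂‖) (by
      intro m hm _
      rw [Finset.mem_range] at hm
      rw [hd m (by omega), norm_mul, norm_qc hq0, mul_comm]
      refine mul_le_mul_of_nonneg_right ((norm_add_le _ _).trans ?_) (Real.rpow_nonneg hq0.le _)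
      simp [hc])
  exact ⟨C, hC, fun m => h m trivial⟩

theorem IsAdmissibleFam.exists_bound {q : ℝ} (hq0 : 0 < q) (hq1 : q < 1) {l₁ : ℤ} (hl₁ : 0 < l₁)
    {a : ℤ → ℕ → ℂ} (ha : IsAdmissibleFam q l₁ a) :
    ∃ C : ℝ, 0 ≤ C ∧ ∀ (n : ℤ) (m : ℕ), q ^ (n : ℝ) * ‖a n m‖ ≤ C * q ^ decayExp n m := by
  obtain ⟨k₁, k₂, k₃, A, B, ha⟩ := ha
  obtain ⟨C, hC, h⟩ := exists_bound_of_regions hq0 hq1 hl₁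
    (fun n m => q ^ (n : ℝ) * ‖a n m‖) ‖k₁‖ ‖k₃‖ (fun n => q ^ (n : ℝ) * ‖A n‖) (fun x => ‖B x‖)
    (2 * l₁)
    (fun n m hn => by simp only [(ha n m).1 hn]; rw [mul_comm])
    (fun n m hn hn' hm => by simp only [(ha n m).2.1 hn hn' (by omega)]; rfl)
    (fun n m hn hx hx' _ => by
      simp only [(ha n m).2.2.2.1 hn hx hx', norm_mul, norm_qc hq0]
      rw [← mul_assoc, ← Real.rpow_add hq0]
      simp)
    (fun n m hx => by
      simp only [(ha n m).2.2.2.2 hx, norm_mul, norm_qc hq0]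
      rw [← mul_assoc, ← Real.rpow_add hq0, mul_comm]
      apply le_of_eq
      congr 2
      ring)
  refine ⟨C + ‖k₂‖, by positivity, fun n m => ?_⟩
  have hp := Real.rpow_nonneg hq0.le (decayExp n m)
  by_cases hnm : n ≤ -l₁ ∧ l₁ ≤ n + (m : ℤ)
  · have hv : decayExp n m = 0 := by
      have : max n 0 + max (-(n + (m : ℤ))) 0 = 0 := by omega
      unfold decayExp; exact_mod_cast this
    rw [(ha n m).2.2.1 hnm.1 hnm.2, norm_mul, norm_qc hq0, ← mul_assoc, ← Real.rpow_add hq0, hv]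
    simpa using hC
  · nlinarith [h n m hnm, mul_nonneg (norm_nonneg k₂) hp]

theorem IsStabilizedFam.exists_bound {q : ℝ} (hq0 : 0 < q) (hq1 : q < 1) {c : ℂ} (hc : ‖c‖ = 1)
    {l₁ : ℤ} (hl₁ : 0 < l₁) {e : ℤ → ℕ → ℂ} (he : IsStabilizedFam q c l₁ e) :
    ∃ C : ℝ, 0 ≤ C ∧ ∀ (n : ℤ) (m : ℕ), ¬(n ≤ -l₁ ∧ l₁ ≤ n + (m : ℤ)) →
      q ^ (-(m : ℝ) / 2) * ‖e n m‖ ≤ C * q ^ decayExp n m := by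
  obtain ⟨u, w, f, v, N, -, he⟩ := he
  have hqn : ‖(q : ℂ)‖ = q := by rw [Complex.norm_real, Real.norm_of_nonneg hq0.le]
  have hz : ∀ n : ℤ, q ^ n = q ^ (n : ℝ) := fun n => (Real.rpow_intCast q n).symm
  have hhalf : ∀ (t : ℝ) (m : ℕ), (q ^ t) ^ m = q ^ (t * m) := fun t m => by
    rw [Real.rpow_mul hq0.le, Real.rpow_natCast]
  refine exists_bound_of_regions hq0 hq1 hl₁ (fun n m => q ^ (-(m : ℝ) / 2) * ‖e n m‖)
    ‖u‖ ‖w‖ (fun n => ‖f n‖) (fun x => ‖v x‖) N ?_ ?_ ?_ ?_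
  · intro n m hn
    simp only [(he n m).1 hn, norm_mul, norm_pow, norm_zpow, norm_qc hq0, hc, hqn, one_pow,
      one_mul, hz, hhalf]
    rw [← mul_assoc, ← Real.rpow_add hq0, ← Real.rpow_add hq0, mul_comm]
    apply le_of_eq
    congr 2
    ring
  · intro n m hn hn' hm
    simp only [(he n m).2.1 hn hn' hm, norm_mul, norm_pow, norm_qc hq0, hc, one_mul, hhalf]
    rw [← mul_assoc, ← Real.rpow_add hq0, show -(m : ℝ) / 2 + 1 / 2 * m = 0 by ring]
    simp
  · intro n m hn hx hx' hm
    simp only [(he n m).2.2.1 hn hx hx' hm, norm_mul, norm_zpow, norm_qc hq0, hc, one_zpow,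
      mul_one]
    rw [← mul_assoc, ← Real.rpow_add hq0, show -(m : ℝ) / 2 + m / 2 = 0 by ring]
    simp
  · intro n m hx
    simp only [(he n m).2.2.2 hx, norm_mul, norm_pow, norm_zpow, norm_inv, norm_qc hq0, hc, hqn,
      one_pow, one_mul, hhalf, inv_zpow', hz]
    rw [← mul_assoc, ← Real.rpow_add hq0, ← Real.rpow_add hq0, mul_comm]
    apply le_of_eq
    congr 2
    push_cast
    ring

/-- In the region left free by `IsStabilizedFam`, the two height exponents agree. -/
theorem height_eq_of_mem_free_region {l₁ n l : ℤ} {m : ℕ} (hl : |l| < l₁)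
    (h : n ≤ -l₁ ∧ l₁ ≤ n + (m : ℤ)) :
    |n + (m : ℤ) + l| + |n + l| = |n + (m : ℤ)| + |n| := by
  rw [abs_lt] at hl
  rw [abs_of_nonneg (by omega : 0 ≤ n + (m : ℤ) + l), abs_of_nonpos (by omega : n + l ≤ 0),
    abs_of_nonneg (by omega : 0 ≤ n + (m : ℤ)), abs_of_nonpos (by omega : n ≤ 0)]
  ring

theorem decay_of_height_ne {n l : ℤ} {m : ℕ}
    (h : |n + (m : ℤ) + l| + |n + l| ≠ |n + (m : ℤ)| + |n|) :
    |n + (m : ℤ)| ≤ |l| + 4 * (max n 0 + max (-(n + (m : ℤ))) 0) ∨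
      |n| ≤ |l| + 4 * (max n 0 + max (-(n + (m : ℤ))) 0) := by
  simp only [Int.abs_eq_natAbs] at *
  omega

theorem abs_height_sub_le (n l : ℤ) (m : ℕ) :
    |(|n + (m : ℤ) + l| + |n + l|) - (|n + (m : ℤ)| + |n|)| ≤ 2 * |l| := by
  simp only [Int.abs_eq_natAbs]
  omega

theorem abs_rpow_height_sub_le_of_small {q : ℝ} (hq0 : 0 < q) (hq1 : q < 1) {s E E' L : ℝ}
    (hs : 0 < s) (hs' : s ≤ 1 / 32) (h : |E - E'| ≤ 2 * L) :
    |q ^ (s * E) - q ^ (s * E')| ≤ 32 * s * (q ^ (-L / 8) * q ^ (s * E')) := by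
  have hL : 0 ≤ L := by linarith [abs_nonneg (E - E')]
  have hlog : Real.log q < 0 := Real.log_neg hq0 hq1
  have h1 : -Real.log q * (2 * L) ≤ 32 * q ^ (-L / 16) := by
    rw [Real.rpow_def_of_pos hq0]
    linarith [Real.add_one_le_exp (Real.log q * (-L / 16))]
  have h2 : s * E' - L / 16 ≤ min (s * E) (s * E') := by
    have := neg_abs_le (E - E')
    refine le_min ?_ (by linarith)
    nlinarith
  have h3 := Real.rpow_le_rpow_of_exponent_ge hq0 hq1.le h2
  calc |q ^ (s * E) - q ^ (s * E')|
      ≤ -Real.log q * |s * E - s * E'| * q ^ min (s * E) (s * E') :=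
        abs_rpow_sub_rpow_le hq0 hq1 _ _
    _ ≤ (s * (32 * q ^ (-L / 16))) * q ^ (s * E' - L / 16) := by
        refine mul_le_mul ?_ h3 (Real.rpow_nonneg hq0.le _) ?_
        · rw [← mul_sub, abs_mul, abs_of_pos hs]
          have : -Real.log q * |E - E'| ≤ -Real.log q * (2 * L) :=
            mul_le_mul_of_nonneg_left h (by linarith)
          nlinarith
        · have := Real.rpow_nonneg hq0.le (-L / 16)
          positivity
    _ = 32 * s * (q ^ (-L / 8) * q ^ (s * E')) := by
        rw [← Real.rpow_add hq0, show -L / 8 + s * E' = -L / 16 + (s * E' - L / 16) by ring,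
          Real.rpow_add hq0]
        ring

theorem abs_rpow_height_sub_le_of_large {q : ℝ} (hq0 : 0 < q) (hq1 : q < 1) {s E E' L : ℝ}
    (hs : 1 / 32 ≤ s) (hE : 0 ≤ E) (hE' : 0 ≤ E') (h : |E - E'| ≤ 2 * L) :
    |q ^ (s * E) - q ^ (s * E')| ≤ 2 * (q ^ (-L / 8) * q ^ (1 / 32 * E')) := by
  have hL : 0 ≤ L := by linarith [abs_nonneg (E - E')]
  have hb := neg_abs_le (E - E')
  rw [← Real.rpow_add hq0]
  have h1 : q ^ (s * E) ≤ q ^ (-L / 8 + 1 / 32 * E') :=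
    Real.rpow_le_rpow_of_exponent_ge hq0 hq1.le (by nlinarith)
  have h2 : q ^ (s * E') ≤ q ^ (-L / 8 + 1 / 32 * E') :=
    Real.rpow_le_rpow_of_exponent_ge hq0 hq1.le (by nlinarith)
  have h3 := Real.rpow_nonneg hq0.le (s * E)
  have h4 := Real.rpow_nonneg hq0.le (s * E')
  rw [abs_le]
  constructor <;> linarith

/-- The dominating family of the triple series. -/
def majorant (q t : ℝ) (p : ℤ × ℤ × ℤ) : ℝ :=
  q ^ (1 / 8 * |(p.1 : ℝ)|) * (q ^ (t * |(p.2.1 : ℝ)|) * q ^ (1 / 8 * |(p.2.2 : ℝ)|)) +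
    q ^ (t * |(p.1 : ℝ)|) * (q ^ (1 / 8 * |(p.2.1 : ℝ)|) * q ^ (1 / 8 * |(p.2.2 : ℝ)|))

theorem majorant_nonneg {q : ℝ} (hq0 : 0 < q) (t : ℝ) (p : ℤ × ℤ × ℤ) : 0 ≤ majorant q t p := by
  unfold majorant
  have nn := fun x : ℝ => Real.rpow_nonneg hq0.le x
  exact add_nonneg (mul_nonneg (nn _) (mul_nonneg (nn _) (nn _)))
    (mul_nonneg (nn _) (mul_nonneg (nn _) (nn _)))

theorem hasSum_majorant {q : ℝ} (hq0 : 0 < q) (hq1 : q < 1) {t : ℝ} (ht : 0 < t) :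
    HasSum (majorant q t) (2 * (∑' z : ℤ, q ^ (1 / 8 * |(z : ℝ)|)) ^ 2 *
      ∑' z : ℤ, q ^ (t * |(z : ℝ)|)) := by
  have h8 := (hasSum_rpow_abs hq0 hq1 (by norm_num : (0 : ℝ) < 1 / 8)).summable
  have hs := (hasSum_rpow_abs hq0 hq1 ht).summable
  have nn : ∀ (r : ℝ) (z : ℤ), 0 ≤ q ^ (r * |(z : ℝ)|) := fun r z => Real.rpow_nonneg hq0.le _
  have prod : ∀ r r' : ℝ, Summable (fun z : ℤ => q ^ (r * |(z : ℝ)|)) →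
      Summable (fun z : ℤ => q ^ (r' * |(z : ℝ)|)) →
      HasSum (fun p : ℤ × ℤ × ℤ => q ^ (r * |(p.1 : ℝ)|) *
        (q ^ (r' * |(p.2.1 : ℝ)|) * q ^ (1 / 8 * |(p.2.2 : ℝ)|)))
        ((∑' z : ℤ, q ^ (r * |(z : ℝ)|)) *
          ((∑' z : ℤ, q ^ (r' * |(z : ℝ)|)) * ∑' z : ℤ, q ^ (1 / 8 * |(z : ℝ)|))) := by
    intro r r' h h'
    have h2 := h'.mul_of_nonneg h8 (nn _) (nn _)
    have h3 := h.mul_of_nonneg h2 (nn _) (fun p => mul_nonneg (nn _ _) (nn _ _))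
    exact h.hasSum.mul (h'.hasSum.mul h8.hasSum h2) h3
  have h := (prod _ _ h8 hs).add (prod _ _ hs h8)
  rwa [show ∀ x y : ℝ, x * (y * x) + y * (x * x) = 2 * x ^ 2 * y from fun x y => by ring] at h

theorem exists_coeff_bound {q : ℝ} (hq0 : 0 < q) (hq1 : q < 1) {c α : ℂ}
    (hc : ‖c‖ = 1) (hα : ‖α‖ = 1) {l₁ : ℤ} (hl₁ : 0 < l₁)
    {d : ℕ → ℂ} (hd : IsAdmissibleSeq q c l₁ d)
    {a b : ℤ → ℕ → ℂ} (ha : IsAdmissibleFam q l₁ a) (hb : IsAdmissibleFam q l₁ b)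
    {e : ℤ → ℤ → ℕ → ℂ} (he : ∀ l : ℤ, |l| < l₁ → IsStabilizedFam q c l₁ (e l))
    {D : ℤ → ℕ → ℤ → ℂ}
    (hD1 : ∀ (n : ℤ) (m : ℕ) (l : ℤ), l₁ ≤ l →
      D n m l = c ^ (2 * n + (m : ℤ) + l) * qc q ((n : ℝ) + ((m : ℝ) + (l : ℝ)) / 2) * a n m)
    (hD2 : ∀ (n : ℤ) (m : ℕ) (l : ℤ), l ≤ -l₁ →
      D n m l = c ^ (2 * n + (m : ℤ) + l) * qc q ((n : ℝ) + ((m : ℝ) - (l : ℝ)) / 2) * b n m)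
    (hD3 : ∀ (n : ℤ) (m : ℕ) (l : ℤ), |l| < l₁ → D n m l = e l n m) :
    ∃ C : ℝ, 0 ≤ C ∧ ∀ (n : ℤ) (m : ℕ) (l : ℤ),
      |n + (m : ℤ) + l| + |n + l| ≠ |n + (m : ℤ)| + |n| →
      ‖α ^ l * qc q (-(m : ℝ)) * d m * D n m l‖ ≤
        C * (q ^ (|(l : ℝ)| / 2) * q ^ decayExp n m) := by
  obtain ⟨Cd, hCd, hd⟩ := hd.exists_bound hq0 hc
  obtain ⟨Ca, hCa, ha⟩ := ha.exists_bound hq0 hq1 hl₁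
  obtain ⟨Cb, hCb, hb⟩ := hb.exists_bound hq0 hq1 hl₁
  have he' : ∀ l : ℤ, ∃ C : ℝ, 0 ≤ C ∧ (|l| < l₁ → ∀ (n : ℤ) (m : ℕ),
      ¬(n ≤ -l₁ ∧ l₁ ≤ n + (m : ℤ)) →
      q ^ (-(m : ℝ) / 2) * ‖e l n m‖ ≤ C * q ^ decayExp n m) := fun l => by
    by_cases hl : |l| < l₁
    · obtain ⟨C, hC, h⟩ := (he l hl).exists_bound hq0 hq1 hc hl₁
      exact ⟨C, hC, fun _ => h⟩
    · exact ⟨0, le_rfl, fun h => absurd h hl⟩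
  choose Ce hCe he' using he'
  set Se := ∑ l ∈ Finset.Ioo (-l₁) l₁, Ce l
  have hSe : 0 ≤ Se := Finset.sum_nonneg fun l _ => hCe l
  have hCS : ∀ l, |l| < l₁ → Ce l ≤ Se := fun l hl =>
    Finset.single_le_sum (f := Ce) (fun l _ => hCe l) (Finset.mem_Ioo.2 (abs_lt.1 hl))
  have nn := fun x : ℝ => Real.rpow_nonneg hq0.le x
  have hR := nn (-(l₁ : ℝ) / 2)
  have hdm : ∀ m : ℕ, q ^ (-(m : ℝ)) * ‖d m‖ ≤ Cd * q ^ (-(m : ℝ) / 2) := fun m => by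
    refine (mul_le_mul_of_nonneg_left (hd m) (nn _)).trans (le_of_eq ?_)
    rw [mul_left_comm, ← Real.rpow_add hq0]
    congr 2
    ring
  have houter : ∀ (x : ℂ) (y C' L : ℝ) (n : ℤ) (m : ℕ), 0 ≤ C' →
      q ^ (n : ℝ) * ‖x‖ ≤ C' * q ^ decayExp n m → y = n + (m + L) / 2 →
      q ^ (-(m : ℝ)) * ‖d m‖ * (q ^ y * ‖x‖) ≤ Cd * C' * (q ^ (L / 2) * q ^ decayExp n m) := by
    intro x y C' L n m hC' hx hy
    calc q ^ (-(m : ℝ)) * ‖d m‖ * (q ^ y * ‖x‖)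
        ≤ Cd * q ^ (-(m : ℝ) / 2) * (q ^ y * ‖x‖) :=
          mul_le_mul_of_nonneg_right (hdm m) (mul_nonneg (nn _) (norm_nonneg _))
      _ = Cd * (q ^ (L / 2) * (q ^ (n : ℝ) * ‖x‖)) := by
          have : q ^ (-(m : ℝ) / 2) * q ^ y = q ^ (L / 2) * q ^ (n : ℝ) := by
            rw [← Real.rpow_add hq0, ← Real.rpow_add hq0, hy]
            congr 1
            ring
          linear_combination Cd * ‖x‖ * this
      _ ≤ Cd * (q ^ (L / 2) * (C' * q ^ decayExp n m)) :=
          mul_le_mul_of_nonneg_left (mul_le_mul_of_nonneg_left hx (nn _)) hCd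
      _ = _ := by ring
  refine ⟨Cd * Ca + Cd * Cb + Cd * Se * q ^ (-(l₁ : ℝ) / 2), by positivity, fun n m l hne => ?_⟩
  rw [norm_mul, norm_mul, norm_mul, norm_zpow, hα, one_zpow, one_mul, norm_qc hq0]
  have e1 : 0 ≤ Cd * Ca * (q ^ (|(l : ℝ)| / 2) * q ^ decayExp n m) := by positivity
  have e2 : 0 ≤ Cd * Cb * (q ^ (|(l : ℝ)| / 2) * q ^ decayExp n m) := by positivity
  have e3 : 0 ≤ Cd * Se * q ^ (-(l₁ : ℝ) / 2) * (q ^ (|(l : ℝ)| / 2) * q ^ decayExp n m) := by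
    positivity
  rw [add_mul, add_mul]
  rcases le_or_gt l₁ l with hl | hl
  · rw [hD1 n m l hl, norm_mul, norm_mul, norm_zpow, hc, one_zpow, one_mul, norm_qc hq0]
    have hl0 : (0 : ℝ) ≤ l := by exact_mod_cast hl₁.le.trans hl
    have := houter (a n m) _ Ca |(l : ℝ)| n m hCa (ha n m) (by rw [abs_of_nonneg hl0])
    linarith
  rcases le_or_gt l (-l₁) with hl' | hl'
  · rw [hD2 n m l hl', norm_mul, norm_mul, norm_zpow, hc, one_zpow, one_mul, norm_qc hq0]
    have hl0 : (l : ℝ) ≤ 0 := by exact_mod_cast hl'.trans (by omega)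
    have := houter (b n m) _ Cb |(l : ℝ)| n m hCb (hb n m)
      (show (n : ℝ) + ((m : ℝ) - (l : ℝ)) / 2 = _ by rw [abs_of_nonpos hl0, sub_eq_add_neg])
    linarith
  · have hab : |l| < l₁ := abs_lt.2 ⟨hl', hl⟩
    rw [hD3 n m l hab]
    have h1 := he' l hab n m fun h => hne (height_eq_of_mem_free_region hab h)
    have h2 : (1 : ℝ) ≤ q ^ (-(l₁ : ℝ) / 2) * q ^ (|(l : ℝ)| / 2) := by
      rw [← Real.rpow_add hq0]
      have : |(l : ℝ)| < l₁ := by exact_mod_cast hab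
      exact Real.one_le_rpow_of_pos_of_le_one_of_nonpos hq0 hq1.le (by linarith)
    have h3 : q ^ (-(m : ℝ)) * ‖d m‖ * ‖e l n m‖ ≤ Cd * (Se * q ^ decayExp n m) :=
      calc _ ≤ Cd * q ^ (-(m : ℝ) / 2) * ‖e l n m‖ :=
            mul_le_mul_of_nonneg_right (hdm m) (norm_nonneg _)
        _ ≤ Cd * (Se * q ^ decayExp n m) := by
            rw [mul_assoc]
            exact mul_le_mul_of_nonneg_left
              (h1.trans (mul_le_mul_of_nonneg_right (hCS l hab) (nn _))) hCd
    have h4 : 0 ≤ Cd * (Se * q ^ decayExp n m) :=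
      mul_nonneg hCd (mul_nonneg hSe (nn _))
    have h5 := mul_le_mul_of_nonneg_left h2 h4
    linarith

theorem norm_term_le {q : ℝ} (hq0 : 0 < q) (hq1 : q < 1) {C κ s t : ℝ} (hC : 0 ≤ C) (hκ : 0 ≤ κ)
    (ht : 0 ≤ t) {n : ℤ} {m : ℕ} {l : ℤ} {K : ℝ}
    (hK : |n + (m : ℤ) + l| + |n + l| ≠ |n + (m : ℤ)| + |n| →
      K ≤ C * (q ^ (|(l : ℝ)| / 2) * q ^ decayExp n m))
    (hdiff : |q ^ (s * (((|n + (m : ℤ) + l| : ℤ) : ℝ) + ((|n + l| : ℤ) : ℝ))) -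
        q ^ (s * (((|n + (m : ℤ)| : ℤ) : ℝ) + ((|n| : ℤ) : ℝ)))| ≤
      κ * (q ^ (-|(l : ℝ)| / 8) *
        q ^ (t * (((|n + (m : ℤ)| : ℤ) : ℝ) + ((|n| : ℤ) : ℝ))))) :
    K * |q ^ (s * (((|n + (m : ℤ) + l| : ℤ) : ℝ) + ((|n + l| : ℤ) : ℝ))) -
        q ^ (s * (((|n + (m : ℤ)| : ℤ) : ℝ) + ((|n| : ℤ) : ℝ)))| ≤
      C * κ * majorant q t (n, n + (m : ℤ), l) := by
  have nn := fun x : ℝ => Real.rpow_nonneg hq0.le x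
  have hfst : 0 ≤ q ^ (1 / 8 * |(n : ℝ)|) *
      (q ^ (t * |((n + m : ℤ) : ℝ)|) * q ^ (1 / 8 * |(l : ℝ)|)) :=
    mul_nonneg (nn _) (mul_nonneg (nn _) (nn _))
  have hsnd : 0 ≤ q ^ (t * |(n : ℝ)|) *
      (q ^ (1 / 8 * |((n + m : ℤ) : ℝ)|) * q ^ (1 / 8 * |(l : ℝ)|)) :=
    mul_nonneg (nn _) (mul_nonneg (nn _) (nn _))
  by_cases hne : |n + (m : ℤ) + l| + |n + l| = |n + (m : ℤ)| + |n|
  · have : (((|n + (m : ℤ) + l| : ℤ) : ℝ) + ((|n + l| : ℤ) : ℝ)) =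
        (((|n + (m : ℤ)| : ℤ) : ℝ) + ((|n| : ℤ) : ℝ)) := by exact_mod_cast hne
    rw [this, sub_self, abs_zero, mul_zero]
    exact mul_nonneg (mul_nonneg hC hκ) (add_nonneg hfst hsnd)
  have hv : |((n + m : ℤ) : ℝ)| ≤ |(l : ℝ)| + 4 * decayExp n m ∨
      |(n : ℝ)| ≤ |(l : ℝ)| + 4 * decayExp n m := by
    unfold decayExp
    exact_mod_cast decay_of_height_ne hne
  refine (mul_le_mul (hK hne) hdiff (abs_nonneg _)
    (mul_nonneg hC (mul_nonneg (nn _) (nn _)))).trans ?_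
  rw [mul_mul_mul_comm]
  refine mul_le_mul_of_nonneg_left ?_ (mul_nonneg hC hκ)
  rw [Int.cast_abs, Int.cast_abs, ← Real.rpow_add hq0, ← Real.rpow_add hq0, ← Real.rpow_add hq0]
  unfold majorant
  have hx := mul_nonneg ht (abs_nonneg ((n + m : ℤ) : ℝ))
  have hn := mul_nonneg ht (abs_nonneg (n : ℝ))
  have hx0 := abs_nonneg ((n + m : ℤ) : ℝ)
  have hn0 := abs_nonneg (n : ℝ)
  rcases hv with hv | hv
  · refine le_trans ?_ (le_add_of_nonneg_left hfst)
    rw [← Real.rpow_add hq0, ← Real.rpow_add hq0]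
    exact Real.rpow_le_rpow_of_exponent_ge hq0 hq1.le (by simp only; linarith)
  · refine le_trans ?_ (le_add_of_nonneg_right hsnd)
    rw [← Real.rpow_add hq0, ← Real.rpow_add hq0]
    exact Real.rpow_le_rpow_of_exponent_ge hq0 hq1.le (by simp only; linarith)

/-- Lemma 5.1 at a finite split place. -/
theorem stmt0 (q : ℝ) (hq0 : 0 < q) (hq1 : q < 1) (c α : ℂ)
    (hc : ‖c‖ = 1) (hα : ‖α‖ = 1) (l₁ : ℤ) (hl₁ : 0 < l₁)
    (d : ℕ → ℂ) (hd : IsAdmissibleSeq q c l₁ d)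
    (a b : ℤ → ℕ → ℂ) (ha : IsAdmissibleFam q l₁ a) (hb : IsAdmissibleFam q l₁ b)
    (e : ℤ → ℤ → ℕ → ℂ) (he : ∀ l : ℤ, |l| < l₁ → IsStabilizedFam q c l₁ (e l))
    (D : ℤ → ℕ → ℤ → ℂ)
    (hD1 : ∀ (n : ℤ) (m : ℕ) (l : ℤ), l₁ ≤ l →
      D n m l = c ^ (2 * n + (m : ℤ) + l) * qc q ((n : ℝ) + ((m : ℝ) + (l : ℝ)) / 2) * a n m)
    (hD2 : ∀ (n : ℤ) (m : ℕ) (l : ℤ), l ≤ -l₁ →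
      D n m l = c ^ (2 * n + (m : ℤ) + l) * qc q ((n : ℝ) + ((m : ℝ) - (l : ℝ)) / 2) * b n m)
    (hD3 : ∀ (n : ℤ) (m : ℕ) (l : ℤ), |l| < l₁ → D n m l = e l n m)
    (T : ℝ → ℤ × ℕ × ℤ → ℂ)
    (hT : ∀ (s : ℝ) (n : ℤ) (m : ℕ) (l : ℤ),
      T s (n, m, l) = α ^ l * qc q (-(m : ℝ)) * d m * D n m l *
        (qc q (s * (((|n + (m : ℤ) + l| : ℤ) : ℝ) + ((|n + l| : ℤ) : ℝ))) -
         qc q (s * (((|n + (m : ℤ)| : ℤ) : ℝ) + ((|n| : ℤ) : ℝ))))) :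
    (∀ s : ℝ, 0 < s → Summable fun p : ℤ × ℕ × ℤ => ‖T s p‖) ∧
    Tendsto (fun s : ℝ => (s : ℂ) * ∑' p : ℤ × ℕ × ℤ, T s p)
      (𝓝[>] (0 : ℝ)) (𝓝 0) := by
  obtain ⟨C, hC, hK⟩ := exists_coeff_bound hq0 hq1 hc hα hl₁ hd ha hb he hD1 hD2 hD3
  have hmaj : ∀ s t κ : ℝ, 0 < t → 0 ≤ κ →
      (∀ E E' L : ℝ, 0 ≤ E → 0 ≤ E' → |E - E'| ≤ 2 * L →
        |q ^ (s * E) - q ^ (s * E')| ≤ κ * (q ^ (-L / 8) * q ^ (t * E'))) →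
      ∀ (n : ℤ) (m : ℕ) (l : ℤ),
        ‖T s (n, m, l)‖ ≤ C * κ * majorant q t (n, n + (m : ℤ), l) := by
    intro s t κ ht hκ hdiff n m l
    have hsub : ∀ x y : ℝ, ‖qc q x - qc q y‖ = |q ^ x - q ^ y| := fun x y => by
      rw [qc, qc, ← Complex.ofReal_sub, Complex.norm_real, Real.norm_eq_abs]
    rw [hT, norm_mul, hsub]
    exact norm_term_le hq0 hq1 hC hκ ht.le (hK n m l) (hdiff _ _ _
      (by positivity) (by positivity) (by exact_mod_cast abs_height_sub_le n l m))
  have hinj : Function.Injective fun p : ℤ × ℕ × ℤ => (p.1, p.1 + (p.2.1 : ℤ), p.2.2) := by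
    rintro ⟨n, m, l⟩ ⟨n', m', l'⟩ h
    simp only [Prod.mk.injEq] at h ⊢
    omega
  have hsum : ∀ s t κ : ℝ, 0 < t → 0 ≤ κ →
      (∀ E E' L : ℝ, 0 ≤ E → 0 ≤ E' → |E - E'| ≤ 2 * L →
        |q ^ (s * E) - q ^ (s * E')| ≤ κ * (q ^ (-L / 8) * q ^ (t * E'))) →
      (Summable fun p => ‖T s p‖) ∧ ‖∑' p, T s p‖ ≤ C * κ * ∑' p, majorant q t p := by
    intro s t κ ht hκ hdiff
    have hM := (hasSum_majorant hq0 hq1 ht).summable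
    have hM' := (hM.comp_injective hinj).mul_left (C * κ)
    have hle : ∀ p, ‖T s p‖ ≤ C * κ * (majorant q t ∘
        fun p : ℤ × ℕ × ℤ => (p.1, p.1 + (p.2.1 : ℤ), p.2.2)) p := fun ⟨n, m, l⟩ =>
      hmaj s t κ ht hκ hdiff n m l
    refine ⟨Summable.of_nonneg_of_le (fun _ => norm_nonneg _) hle hM', ?_⟩
    refine (tsum_of_norm_bounded hM'.hasSum hle).trans ?_
    rw [tsum_mul_left]
    refine mul_le_mul_of_nonneg_left ?_ (mul_nonneg hC hκ)
    exact tsum_comp_le_tsum_of_inj hM (majorant_nonneg hq0 t) hinj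
  have hsmall : ∀ s : ℝ, 0 < s → s ≤ 1 / 32 → (Summable fun p => ‖T s p‖) ∧
      ‖∑' p, T s p‖ ≤ C * (32 * s) * ∑' p, majorant q s p := fun s hs hs' =>
    hsum s s (32 * s) hs (by positivity) fun _ _ _ _ _ h =>
      abs_rpow_height_sub_le_of_small hq0 hq1 hs hs' h
  constructor
  · intro s hs
    rcases le_total s (1 / 32) with h | h
    · exact (hsmall s hs h).1
    · exact (hsum s (1 / 32) 2 (by norm_num) (by norm_num) fun _ _ _ hE hE' h' =>
        abs_rpow_height_sub_le_of_large hq0 hq1 h hE hE' h').1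
  · set H := ∑' z : ℤ, q ^ (1 / 8 * |(z : ℝ)|)
    refine squeeze_zero_norm' (a := fun s => s * (C * 64 * H ^ 2 * (2 / (1 - q)))) ?_ ?_
    · filter_upwards [Ioc_mem_nhdsGT (by norm_num : (0 : ℝ) < 1 / 32)] with s hs
      have h1 := (hsmall s hs.1 hs.2).2
      rw [(hasSum_majorant hq0 hq1 hs.1).tsum_eq] at h1
      have h2 := mul_tsum_rpow_abs_le hq0 hq1 hs.1 (hs.2.trans (by norm_num))
      rw [norm_mul, Complex.norm_real, Real.norm_of_nonneg hs.1.le]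
      refine mul_le_mul_of_nonneg_left (h1.trans ?_) hs.1.le
      calc C * (32 * s) * (2 * H ^ 2 * ∑' z : ℤ, q ^ (s * |(z : ℝ)|))
          = C * 64 * H ^ 2 * (s * ∑' z : ℤ, q ^ (s * |(z : ℝ)|)) := by ring
        _ ≤ _ := mul_le_mul_of_nonneg_left h2 (by positivity)
    · have : Tendsto (fun s : ℝ => s * (C * 64 * H ^ 2 * (2 / (1 - q)))) (𝓝 0) (𝓝 0) := by
        have h := (continuous_mul_const (C * 64 * H ^ 2 * (2 / (1 - q)))).tendsto 0
        rwa [zero_mul] at h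
      exact this.mono_left nhdsWithin_le_nhds
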